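/- Let d ≥ 2 be an integer and set c_* = 1/(d+1). For ε > 0 define g_*^−(ε) = (1 − √(1 + (1−c_*)/sinh²(ε/2)))/2 and μ_*(ε) = d·g_*^−(ε)/(d·g_*^−(ε) − 1), and let L(x) = x·log x. Then as ε → 0 from the right, (log d + L(1 − μ_*(ε) + μ_*(ε)/d) + (d−1)·L(μ_*(ε)/d))/ε² tends to (d² − 1)/(2d³). -/

import Mathlib

/-- `L(x) = x log x`. -/
noncomputable def LPUT (x : ℝ) : ℝ := x * Real.log x

open Filter Topology

/-- Second-order expansion of `x log x` at `1`. -/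
theorem tendsto_LPUT_one_add_sub_div_sq :
    Tendsto (fun x : ℝ => (LPUT (1 + x) - x) / x ^ 2) (𝓝[≠] 0) (𝓝 (1 / 2)) := by
  have hpos : ∀ᶠ x : ℝ in 𝓝 0, 0 < 1 + x := by
    filter_upwards [lt_mem_nhds (show (-1 : ℝ) < 0 by norm_num)] with x hx
    linarith
  have hlog : ∀ x : ℝ, 0 < 1 + x → HasDerivAt (fun y : ℝ => Real.log (1 + y)) (1 / (1 + x)) x :=
    fun x hx => ((hasDerivAt_id' x).const_add 1).log hx.ne'
  have hnum : ∀ x : ℝ, 0 < 1 + x →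
      HasDerivAt (fun y : ℝ => LPUT (1 + y) - y) (Real.log (1 + x)) x := by
    intro x hx
    have h := (((hasDerivAt_id' x).const_add 1).mul (hlog x hx)).sub (hasDerivAt_id' x)
    have hval : 1 * Real.log (1 + x) + (1 + x) * (1 / (1 + x)) - 1 = Real.log (1 + x) := by
      rw [mul_one_div_cancel hx.ne']
      ring
    rw [hval] at h
    exact h
  have hcont : Tendsto (fun y : ℝ => LPUT (1 + y) - y) (𝓝[≠] 0) (𝓝 0) := by
    have h := (hnum 0 (by norm_num)).continuousAt.tendsto
    simp only [LPUT, add_zero, Real.log_one, mul_zero, sub_zero] at h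
    exact h.mono_left nhdsWithin_le_nhds
  refine HasDerivAt.lhopital_zero_nhdsNE (f' := fun x => Real.log (1 + x)) (g' := fun x => 2 * x)
    ?_ ?_ ?_ hcont ?_ ?_
  · filter_upwards [nhdsWithin_le_nhds hpos] with x hx using hnum x hx
  · filter_upwards with x
    simpa using hasDerivAt_pow 2 x
  · filter_upwards [self_mem_nhdsWithin] with x hx
    simpa using hx
  · have h : Tendsto (fun x : ℝ => x ^ 2) (𝓝 0) (𝓝 (0 ^ 2)) := (continuous_pow 2).tendsto 0
    rw [zero_pow two_ne_zero] at h
    exact h.mono_left nhdsWithin_le_nhds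
  · have h := (hasDerivAt_iff_tendsto_slope.1 (hlog 0 (by norm_num))).div_const 2
    simp only [add_zero, div_one] at h
    refine h.congr fun x => ?_
    simp only [slope_def_field, add_zero, Real.log_one, sub_zero]
    rw [div_div, mul_comm]

theorem tendsto_div_sinh_half :
    Tendsto (fun x : ℝ => x / Real.sinh (x / 2)) (𝓝[>] 0) (𝓝 2) := by
  have h0 : HasDerivAt (fun x : ℝ => Real.sinh (x / 2)) (Real.cosh (0 / 2) * (1 / 2)) 0 :=
    ((hasDerivAt_id' (0 : ℝ)).div_const 2).sinh
  have h := (hasDerivAt_iff_tendsto_slope.1 h0).mono_left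
    (nhdsWithin_mono 0 fun x (hx : 0 < x) => hx.ne')
  have h2 := h.inv₀ (by simp)
  simp only [zero_div, Real.cosh_zero, one_mul, one_div, inv_inv] at h2
  refine h2.congr fun x => ?_
  simp [slope_def_field]

/-- The utility is `1 / d` times a combination of `LPUT` at perturbations of `1`. -/
theorem log_add_LPUT_eq {d δ : ℝ} (hd : 1 < d) (hδ : 0 < δ) (hδ1 : δ < 1) :
    Real.log d + LPUT (1 - (1 - δ) + (1 - δ) / d) + (d - 1) * LPUT ((1 - δ) / d)
      = (LPUT (1 + (d - 1) * δ) + (d - 1) * LPUT (1 + -δ)) / d := by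
  have h1 : 1 - (1 - δ) + (1 - δ) / d = (1 + (d - 1) * δ) / d := by
    field_simp
    ring
  have h2 : 0 < 1 + (d - 1) * δ := by nlinarith
  rw [h1, ← sub_eq_add_neg]
  simp only [LPUT]
  rw [Real.log_div h2.ne' (by linarith), Real.log_div (by linarith) (by linarith)]
  field_simp
  ring

/-- With `c_* = 1/(d+1)`, as `ε → 0⁺`, the asymmetric-testing
utility of the proposed quantum mechanism satisfies
`(log d + L(1 - μ_*(ε) + μ_*(ε)/d) + (d-1) L(μ_*(ε)/d))/ε² → (d²-1)/(2d³)`. -/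
theorem stmt_17 (d : ℕ) (hd : 2 ≤ d)
    (cs : ℝ) (hcs : cs = 1 / ((d : ℝ) + 1))
    (g μst : ℝ → ℝ)
    (hg : ∀ ε : ℝ, g ε = (1 - Real.sqrt (1 + (1 - cs) / Real.sinh (ε / 2) ^ 2)) / 2)
    (hμ : ∀ ε : ℝ, μst ε = (d : ℝ) * g ε / ((d : ℝ) * g ε - 1)) :
    Filter.Tendsto (fun ε : ℝ =>
        (Real.log d + LPUT (1 - μst ε + μst ε / d)
          + ((d : ℝ) - 1) * LPUT (μst ε / d)) / ε ^ 2)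
      (nhdsWithin 0 (Set.Ioi 0))
      (nhds (((d : ℝ) ^ 2 - 1) / (2 * (d : ℝ) ^ 3))) := by
  have hd' : (1 : ℝ) < d := by exact_mod_cast hd
  generalize (d : ℝ) = D at *
  have hD : 0 < D := by linarith
  have hcs' : 1 - cs = D / (D + 1) := by
    rw [hcs]
    field_simp
    ring
  have hc : 0 < 1 - cs := by rw [hcs']; positivity
  have hgneg : ∀ ε : ℝ, 0 < ε → g ε < 0 := by
    intro ε hε
    have hs : 0 < Real.sinh (ε / 2) := Real.sinh_pos_iff.2 (by linarith)
    have : 1 < Real.sqrt (1 + (1 - cs) / Real.sinh (ε / 2) ^ 2) := by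
      rw [Real.lt_sqrt zero_le_one, one_pow]
      have : 0 < (1 - cs) / Real.sinh (ε / 2) ^ 2 := by positivity
      linarith
    rw [hg]
    linarith
  set δ : ℝ → ℝ := fun ε => 1 / (1 - D * g ε) with hδdef
  have hden : ∀ ε : ℝ, 0 < ε → 1 < 1 - D * g ε := by
    intro ε hε
    nlinarith [mul_pos hD (neg_pos.2 (hgneg ε hε))]
  have hδpos : ∀ ε : ℝ, 0 < ε → 0 < δ ε := fun ε hε =>
    one_div_pos.2 (zero_lt_one.trans (hden ε hε))
  have hδlt : ∀ ε : ℝ, 0 < ε → δ ε < 1 := fun ε hε => by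
    have := hden ε hε
    simp only [hδdef]
    rw [div_lt_one (by linarith)]
    exact this
  have hμδ : ∀ ε : ℝ, 0 < ε → μst ε = 1 - δ ε := by
    intro ε hε
    have h1 : 1 - D * g ε ≠ 0 := by linarith [hden ε hε]
    have h2 : D * g ε - 1 ≠ 0 := by
      intro h
      exact h1 (by linarith)
    rw [hμ]
    simp only [hδdef]
    field_simp
    ring
  have hid : Tendsto (fun ε : ℝ => ε) (𝓝[>] 0) (𝓝 0) := nhdsWithin_le_nhds
  have hεg : Tendsto (fun ε : ℝ => ε * g ε) (𝓝[>] 0) (𝓝 (-Real.sqrt (1 - cs))) := by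
    have h := ((hid.sub (((hid.pow 2).add
      ((tendsto_div_sinh_half.pow 2).const_mul (1 - cs))).sqrt)).div_const 2)
    have hlim : (0 - Real.sqrt (0 ^ 2 + (1 - cs) * 2 ^ 2)) / 2 = -Real.sqrt (1 - cs) := by
      rw [zero_pow two_ne_zero, zero_add, Real.sqrt_mul hc.le, Real.sqrt_sq zero_le_two]
      ring
    rw [hlim] at h
    refine h.congr' ?_
    filter_upwards [self_mem_nhdsWithin] with ε hε
    have hε : 0 < ε := hε
    have hfac : ε ^ 2 + (1 - cs) * (ε / Real.sinh (ε / 2)) ^ 2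
        = ε ^ 2 * (1 + (1 - cs) / Real.sinh (ε / 2) ^ 2) := by ring
    rw [hg, hfac, Real.sqrt_mul (sq_nonneg ε), Real.sqrt_sq hε.le]
    ring
  have hratio : Tendsto (fun ε => δ ε / ε) (𝓝[>] 0) (𝓝 (1 / (D * Real.sqrt (1 - cs)))) := by
    have hsq := Real.sqrt_pos.2 hc
    have h := (hid.sub (hεg.const_mul D)).inv₀ (by
      have := mul_pos hD hsq
      linarith)
    have hlim : (0 - D * -Real.sqrt (1 - cs))⁻¹ = 1 / (D * Real.sqrt (1 - cs)) := by
      rw [one_div]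
      congr 1
      ring
    rw [hlim] at h
    refine h.congr fun ε => ?_
    simp only [hδdef]
    rw [div_div, one_div]
    congr 1
    ring
  have hδ0 : Tendsto δ (𝓝[>] 0) (𝓝 0) := by
    have h := hratio.mul hid
    rw [mul_zero] at h
    refine h.congr' ?_
    filter_upwards [self_mem_nhdsWithin] with ε hε
    exact div_mul_cancel₀ _ (ne_of_gt hε)
  have ht1 : Tendsto (fun ε => (D - 1) * δ ε) (𝓝[>] 0) (𝓝[≠] 0) := by
    refine tendsto_nhdsWithin_iff.2 ⟨by simpa using hδ0.const_mul (D - 1), ?_⟩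
    filter_upwards [self_mem_nhdsWithin] with ε hε
    exact (mul_pos (by linarith) (hδpos ε hε)).ne'
  have ht2 : Tendsto (fun ε => -δ ε) (𝓝[>] 0) (𝓝[≠] 0) := by
    refine tendsto_nhdsWithin_iff.2 ⟨by simpa using hδ0.neg, ?_⟩
    filter_upwards [self_mem_nhdsWithin] with ε hε
    exact neg_ne_zero.2 (hδpos ε hε).ne'
  have hmain := (((((tendsto_LPUT_one_add_sub_div_sq.comp ht1).const_mul ((D - 1) ^ 2)).add
    ((tendsto_LPUT_one_add_sub_div_sq.comp ht2).const_mul (D - 1))).div_const D).mul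
      (hratio.pow 2))
  have hlim : ((D - 1) ^ 2 * (1 / 2) + (D - 1) * (1 / 2)) / D *
      (1 / (D * Real.sqrt (1 - cs))) ^ 2 = (D ^ 2 - 1) / (2 * D ^ 3) := by
    rw [div_pow, mul_pow, Real.sq_sqrt hc.le, hcs']
    field_simp
    ring
  rw [hlim] at hmain
  refine hmain.congr' ?_
  filter_upwards [self_mem_nhdsWithin] with ε hε
  have hε : 0 < ε := hε
  have hδε := (hδpos ε hε).ne'
  have hD1 : D - 1 ≠ 0 := by linarith
  rw [hμδ ε hε, log_add_LPUT_eq hd' (hδpos ε hε) (hδlt ε hε)]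
  simp only [Function.comp_apply]
  generalize δ ε = t at *
  generalize LPUT (1 + (D - 1) * t) = a
  generalize LPUT (1 + -t) = b
  field_simp
  ring
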